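/- For every complex-valued u ∈ C_0^∞(ℝ² \ {0}) (smooth with compact support contained in ℝ² minus the origin) the weighted Gårding type inequality ∫_{ℝ²} |∇₂u|² · log(1/(e²|x|)) dx ≤ Re ∫_{ℝ²} (Δ²u) · conj(u) · log(1/|x|) dx holds, where |∇₂u|² = |∂²u/∂x₁²|² + 2|∂²u/∂x₁∂x₂|² + |∂²u/∂x₂²|² and Δ² is the biharmonic operator. -/

import Mathlib

open MeasureTheory
open scoped Real

noncomputable section

/-- Euclidean plane. -/
abbrev E2 := EuclideanSpace ℝ (Fin 2)

/-- Partial derivative of a complex-valued function on `ℝ²` in the `i`-th coordinate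
direction. -/
def pd (i : Fin 2) (u : E2 → ℂ) (x : E2) : ℂ :=
  fderiv ℝ u x (EuclideanSpace.single i 1)

/-- The Laplacian of a complex-valued function on `ℝ²`. -/
def lap (u : E2 → ℂ) (x : E2) : ℂ :=
  pd 0 (pd 0 u) x + pd 1 (pd 1 u) x

/-- Squared norm of the full Hessian:
`|∇₂u|² = |u_{x₁x₁}|² + 2|u_{x₁x₂}|² + |u_{x₂x₂}|²`. -/
def hess2 (u : E2 → ℂ) (x : E2) : ℝ :=
  ‖pd 0 (pd 0 u) x‖ ^ 2 + 2 * ‖pd 0 (pd 1 u) x‖ ^ 2 + ‖pd 1 (pd 1 u) x‖ ^ 2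

/-- Partial derivative of a real-valued function on the plane. -/
def rpd (i : Fin 2) (f : E2 → ℝ) (x : E2) : ℝ :=
  fderiv ℝ f x (EuclideanSpace.single i 1)

/-- The Laplacian of a real-valued function on the plane. -/
def rlap (f : E2 → ℝ) (x : E2) : ℝ :=
  rpd 0 (rpd 0 f) x + rpd 1 (rpd 1 f) x

/-- Squared norm of the Hessian of a real-valued function on the plane. -/
def rhess2 (f : E2 → ℝ) (x : E2) : ℝ :=
  rpd 0 (rpd 0 f) x ^ 2 + 2 * rpd 0 (rpd 1 f) x ^ 2 + rpd 1 (rpd 1 f) x ^ 2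

/-- The angular derivative `x₁∂₂ - x₂∂₁`. -/
def angularDeriv (f : E2 → ℝ) (x : E2) : ℝ :=
  x 0 * rpd 1 f x - x 1 * rpd 0 f x

/-- The inverse square `|x|⁻²`. -/
def invSq (x : E2) : ℝ := (x 0 ^ 2 + x 1 ^ 2)⁻¹

/-- The logarithmic weight `log (1 / |x|)`. -/
def logWeight (x : E2) : ℝ := -(1 / 2) * Real.log (x 0 ^ 2 + x 1 ^ 2)

section Calculus

variable {f g : E2 → ℝ} {x : E2} {i : Fin 2}

lemma rpd_add (hf : DifferentiableAt ℝ f x) (hg : DifferentiableAt ℝ g x) :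
    rpd i (fun y => f y + g y) x = rpd i f x + rpd i g x := by
  simp [rpd, fderiv_fun_add hf hg]

lemma rpd_sub (hf : DifferentiableAt ℝ f x) (hg : DifferentiableAt ℝ g x) :
    rpd i (fun y => f y - g y) x = rpd i f x - rpd i g x := by
  simp [rpd, fderiv_fun_sub hf hg]

lemma rpd_neg : rpd i (fun y => -f y) x = -rpd i f x := by
  simp [rpd, fderiv_fun_neg]

lemma rpd_mul (hf : DifferentiableAt ℝ f x) (hg : DifferentiableAt ℝ g x) :
    rpd i (fun y => f y * g y) x = f x * rpd i g x + g x * rpd i f x := by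
  simp [rpd, fderiv_fun_mul hf hg]

lemma rpd_const (c : ℝ) : rpd i (fun _ => c) x = 0 := by
  simp [rpd]

lemma rpd_const_mul (c : ℝ) (hf : DifferentiableAt ℝ f x) :
    rpd i (fun y => c * f y) x = c * rpd i f x := by
  simp [rpd, fderiv_const_mul hf c]

lemma rpd_pow_two (hf : DifferentiableAt ℝ f x) :
    rpd i (fun y => f y ^ 2) x = 2 * f x * rpd i f x := by
  simp only [pow_two, rpd_mul hf hf]
  ring

lemma rpd_coord (j : Fin 2) : rpd i (fun y => y j) x = if j = i then 1 else 0 := by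
  have : (fun y : E2 => y j) = EuclideanSpace.proj (𝕜 := ℝ) j := by ext; simp
  rw [rpd, this, ContinuousLinearMap.fderiv]
  simp

lemma sq_add_sq_pos_of_ne_zero (hx : x ≠ 0) : 0 < x 0 ^ 2 + x 1 ^ 2 := by
  have h : 0 < ‖x‖ ^ 2 := by positivity
  simpa [EuclideanSpace.norm_sq_eq] using h

lemma contDiffAt_invSq (hx : x ≠ 0) {n : WithTop ℕ∞} : ContDiffAt ℝ n invSq x := by
  unfold invSq
  exact ContDiffAt.inv (by fun_prop) (sq_add_sq_pos_of_ne_zero hx).ne'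

lemma contDiffAt_logWeight (hx : x ≠ 0) {n : WithTop ℕ∞} : ContDiffAt ℝ n logWeight x := by
  unfold logWeight
  exact contDiffAt_const.mul (ContDiffAt.log (by fun_prop) (sq_add_sq_pos_of_ne_zero hx).ne')

lemma rpd_sq_add_sq : rpd i (fun y => y 0 ^ 2 + y 1 ^ 2) x = 2 * x i := by
  rw [rpd_add (by fun_prop) (by fun_prop), rpd_pow_two (by fun_prop), rpd_pow_two (by fun_prop),
    rpd_coord, rpd_coord]
  fin_cases i <;> simp

lemma rpd_invSq (hx : x ≠ 0) : rpd i invSq x = -(2 * x i * invSq x ^ 2) := by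
  have h : HasFDerivAt (fun y : E2 => (y 0 ^ 2 + y 1 ^ 2)⁻¹) _ x :=
    (hasDerivAt_inv (sq_add_sq_pos_of_ne_zero hx).ne').comp_hasFDerivAt x
      (show DifferentiableAt ℝ (fun y : E2 => y 0 ^ 2 + y 1 ^ 2) x by fun_prop).hasFDerivAt
  have h' := rpd_sq_add_sq (x := x) (i := i)
  unfold rpd at h' ⊢
  unfold invSq
  rw [h.fderiv, smul_apply, h', smul_eq_mul, inv_pow]
  ring

lemma rpd_logWeight (hx : x ≠ 0) : rpd i logWeight x = -(x i * invSq x) := by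
  have h := (show DifferentiableAt ℝ (fun y : E2 => y 0 ^ 2 + y 1 ^ 2) x by
    fun_prop).hasFDerivAt.log (sq_add_sq_pos_of_ne_zero hx).ne'
  have h' := rpd_sq_add_sq (x := x) (i := i)
  have hd : rpd i logWeight x =
      -(1 / 2) * rpd i (fun y => Real.log (y 0 ^ 2 + y 1 ^ 2)) x :=
    rpd_const_mul _ h.differentiableAt
  rw [hd]
  unfold rpd at h' ⊢
  unfold invSq
  rw [h.fderiv, smul_apply, h', smul_eq_mul]
  ring

lemma logWeight_eq (x : E2) : logWeight x = Real.log (1 / ‖x‖) := by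
  have h : x 0 ^ 2 + x 1 ^ 2 = ‖x‖ ^ 2 := by simp [EuclideanSpace.norm_sq_eq]
  rw [logWeight, h, Real.log_pow, one_div ‖x‖, Real.log_inv]
  push_cast
  ring

lemma ContDiff.rpd {n m : WithTop ℕ∞} (hf : ContDiff ℝ n f) (hm : m + 1 ≤ n) (i : Fin 2) :
    ContDiff ℝ m (rpd i f) :=
  (hf.fderiv_right hm).clm_apply contDiff_const

lemma rpd_comm (hf : ContDiff ℝ 2 f) (i j : Fin 2) :
    rpd i (rpd j f) = rpd j (rpd i f) := by
  have key (i j : Fin 2) (x : E2) : rpd i (rpd j f) x =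
      fderiv ℝ (fderiv ℝ f) x (EuclideanSpace.single i 1) (EuclideanSpace.single j 1) := by
    have hd : DifferentiableAt ℝ (fderiv ℝ f) x :=
      (hf.fderiv_right (m := 1) (by norm_num)).differentiable (by norm_num) x
    have : rpd j f = fun y => fderiv ℝ f y (EuclideanSpace.single j 1) := rfl
    rw [this]
    unfold rpd
    rw [fderiv_clm_apply hd (by fun_prop)]
    simp
  ext x
  rw [key, key]
  exact (hf.contDiffAt.isSymmSndFDerivAt (by simp)) _ _

lemma tsupport_rpd_subset (f : E2 → ℝ) (i : Fin 2) : tsupport (rpd i f) ⊆ tsupport f :=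
  tsupport_fderiv_apply_subset ℝ _

lemma rpd_eq_zero_of_notMem (hx : x ∉ tsupport f) : rpd i f x = 0 :=
  image_eq_zero_of_notMem_tsupport fun h => hx (tsupport_rpd_subset f i h)

end Calculus

section Support

variable {p f : E2 → ℝ}

lemma contDiff_of_forall_mem_tsupport {n : WithTop ℕ∞}
    (hf : ∀ x ∈ tsupport p, ContDiffAt ℝ n f x) (h : ∀ x ∉ tsupport p, f x = 0) :
    ContDiff ℝ n f := by
  rw [contDiff_iff_contDiffAt]
  intro x
  by_cases hx : x ∈ tsupport p
  · exact hf x hx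
  · refine (contDiffAt_const (c := (0 : ℝ))).congr_of_eventuallyEq ?_
    filter_upwards [(isClosed_tsupport p).isOpen_compl.mem_nhds hx] with y hy using h y hy

lemma integral_rpd_eq_zero (hf : ContDiff ℝ 1 f) (hs : HasCompactSupport f) (i : Fin 2) :
    ∫ x, rpd i f x = 0 := by
  have hc : HasCompactSupport (rpd i f) :=
    HasCompactSupport.intro hs fun x hx => rpd_eq_zero_of_notMem hx
  have hi : Integrable (rpd i f) :=
    (hf.rpd (m := 0) (by norm_num) i).continuous.integrable_of_hasCompactSupport hc
  have h := integral_bilinear_hasLineDerivAt_right_eq_neg_left_of_integrable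
    (μ := (volume : Measure E2)) (f := fun _ => (1 : ℝ)) (f' := fun _ => 0) (g := f)
    (g' := rpd i f) (v := EuclideanSpace.single i 1) (B := ContinuousLinearMap.mul ℝ ℝ)
    (by simp) (by simpa using hi)
    (by simpa using hf.continuous.integrable_of_hasCompactSupport hs)
    (fun x _ => by simp [HasLineDerivAt, hasDerivAt_const])
    (fun x _ => (hf.differentiable (by norm_num) x).hasFDerivAt.hasLineDerivAt _)
  simpa using h

end Support

/-- The quarter-turn `(x₁, x₂) ↦ (-x₂, x₁)`, in coordinates. -/
def quarterTurn (i : Fin 2) (x : E2) : ℝ := if i = 0 then -x 1 else x 0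

/-- The flux relating `Δ²p · p · log (1 / |x|)` to the weighted Hessian of `p`. -/
def hessFlux (p : E2 → ℝ) (i : Fin 2) (x : E2) : ℝ :=
  rpd i (rlap p) x * p x * logWeight x + rlap p x * p x * (x i * invSq x)
    - (rpd 0 p x * rpd i (rpd 0 p) x + rpd 1 p x * rpd i (rpd 1 p) x) * logWeight x
    - rpd i p x * (x 0 * rpd 0 p x + x 1 * rpd 1 p x) * invSq x

/-- The flux relating the radial and angular derivatives of `p` to its tangential second
derivative. -/
def angularFlux (p : E2 → ℝ) (i : Fin 2) (x : E2) : ℝ :=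
  quarterTurn i x * (4 * (x 0 * rpd 0 p x + x 1 * rpd 1 p x) * angularDeriv p x
      - 2 * p x * angularDeriv p x) * invSq x ^ 2
    + x i * (p x ^ 2 - 2 * angularDeriv p x ^ 2) * invSq x ^ 2

open scoped ContDiff

section Divergence

variable {p : E2 → ℝ} {x : E2}

lemma differentiable_rpd {f : E2 → ℝ} (hf : ContDiff ℝ ∞ f) (i : Fin 2) :
    Differentiable ℝ (rpd i f) :=
  (hf.rpd (m := 1) (by norm_cast) i).differentiable (by norm_num)

lemma contDiff_rpd {f : E2 → ℝ} (hf : ContDiff ℝ ∞ f) (i : Fin 2) : ContDiff ℝ ∞ (rpd i f) :=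
  hf.rpd (by norm_cast) i

lemma contDiff_rlap (hp : ContDiff ℝ ∞ p) : ContDiff ℝ ∞ (rlap p) :=
  (contDiff_rpd (contDiff_rpd hp 0) 0).add (contDiff_rpd (contDiff_rpd hp 1) 1)

lemma contDiff_angularDeriv (hp : ContDiff ℝ ∞ p) : ContDiff ℝ ∞ (angularDeriv p) := by
  have h0 := contDiff_rpd hp 0
  have h1 := contDiff_rpd hp 1
  unfold angularDeriv
  fun_prop

lemma rpd_angularDeriv (hp : ContDiff ℝ ∞ p) (i : Fin 2) (x : E2) :
    rpd i (angularDeriv p) x = x 0 * rpd i (rpd 1 p) x - x 1 * rpd i (rpd 0 p) x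
      + (if i = 0 then rpd 1 p x else -rpd 0 p x) := by
  have h0 := differentiable_rpd hp 0
  have h1 := differentiable_rpd hp 1
  generalize hp0 : rpd 0 p = p0 at h0
  generalize hp1 : rpd 1 p = p1 at h1
  unfold angularDeriv
  rw [hp0, hp1, rpd_sub (by fun_prop) (by fun_prop), rpd_mul (by fun_prop) (by fun_prop),
    rpd_mul (by fun_prop) (by fun_prop), rpd_coord, rpd_coord]
  fin_cases i <;> simp <;> ring

lemma angularDeriv_angularDeriv (hp : ContDiff ℝ ∞ p) (x : E2) :
    angularDeriv (angularDeriv p) x = x 1 ^ 2 * rpd 0 (rpd 0 p) x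
      - 2 * x 0 * x 1 * rpd 0 (rpd 1 p) x + x 0 ^ 2 * rpd 1 (rpd 1 p) x
      - x 0 * rpd 0 p x - x 1 * rpd 1 p x := by
  rw [angularDeriv, rpd_angularDeriv hp, rpd_angularDeriv hp,
    rpd_comm (hp.of_le (by norm_cast)) 1 0]
  simp
  ring

lemma rpd_rlap (hp : ContDiff ℝ ∞ p) (i : Fin 2) (x : E2) :
    rpd i (rlap p) x = rpd i (rpd 0 (rpd 0 p)) x + rpd i (rpd 1 (rpd 1 p)) x :=
  rpd_add (differentiable_rpd (contDiff_rpd hp 0) 0 x)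
    (differentiable_rpd (contDiff_rpd hp 1) 1 x)

lemma invSq_mul (hx : x ≠ 0) : invSq x * (x 0 ^ 2 + x 1 ^ 2) = 1 :=
  inv_mul_cancel₀ (sq_add_sq_pos_of_ne_zero hx).ne'

lemma rpd_hessFlux (hp : ContDiff ℝ ∞ p) (hx : x ≠ 0) (i : Fin 2) :
    rpd i (hessFlux p i) x =
      rpd i (rpd i (rlap p)) x * p x * logWeight x
      + rpd i (rlap p) x * rpd i p x * logWeight x
      - 2 * rlap p x * p x * (x i) ^ 2 * invSq x ^ 2
      + rlap p x * rpd i p x * x i * invSq x + rlap p x * p x * invSq x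
      - (rpd i (rpd 0 p) x ^ 2 + rpd i (rpd 1 p) x ^ 2
        + rpd 0 p x * rpd i (rpd i (rpd 0 p)) x
        + rpd 1 p x * rpd i (rpd i (rpd 1 p)) x) * logWeight x
      + (rpd 0 p x * rpd i (rpd 0 p) x + rpd 1 p x * rpd i (rpd 1 p) x) * x i * invSq x
      - rpd i (rpd i p) x * (x 0 * rpd 0 p x + x 1 * rpd 1 p x) * invSq x
      - rpd i p x * (rpd i p x + x 0 * rpd i (rpd 0 p) x + x 1 * rpd i (rpd 1 p) x) * invSq x
      + rpd i p x * (x 0 * rpd 0 p x + x 1 * rpd 1 p x) * (2 * x i * invSq x ^ 2) := by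
  have hw : DifferentiableAt ℝ logWeight x :=
    (contDiffAt_logWeight hx (n := 1)).differentiableAt (by norm_num)
  have hσ : DifferentiableAt ℝ invSq x :=
    (contDiffAt_invSq hx (n := 1)).differentiableAt (by norm_num)
  have hdp : Differentiable ℝ p := hp.differentiable (by norm_num)
  have h0 := differentiable_rpd hp 0
  have h1 := differentiable_rpd hp 1
  have hi := differentiable_rpd hp i
  have hi0 := differentiable_rpd (contDiff_rpd hp 0) i
  have hi1 := differentiable_rpd (contDiff_rpd hp 1) i
  have hq := (contDiff_rlap hp).differentiable (by norm_num)
  have hqi := differentiable_rpd (contDiff_rlap hp) i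
  have ew := rpd_logWeight hx (i := i)
  have eσ := rpd_invSq hx (i := i)
  unfold hessFlux
  generalize ei : rpd i p = pi at *
  generalize e0 : rpd 0 p = p0 at *
  generalize e1 : rpd 1 p = p1 at *
  generalize ei0 : rpd i p0 = pi0 at *
  generalize ei1 : rpd i p1 = pi1 at *
  generalize eq : rlap p = q at *
  generalize eqi : rpd i q = qi at *
  have hdi : DifferentiableAt ℝ pi x := hi x
  simp (disch := fun_prop) only [rpd_add, rpd_sub, rpd_mul, rpd_coord, ew, eσ, ei, ei0, ei1, eqi]
  fin_cases i
  · have hpi : pi = p0 := by rw [← ei, ← e0]; rfl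
    simp [hpi]
    ring
  · have hpi : pi = p1 := by rw [← ei, ← e1]; rfl
    simp [hpi]
    ring

lemma div_hessFlux (hp : ContDiff ℝ ∞ p) (hx : x ≠ 0) :
    rpd 0 (hessFlux p 0) x + rpd 1 (hessFlux p 1) x =
      rlap (rlap p) x * p x * logWeight x - rhess2 p x * logWeight x
      + invSq x ^ 2 * ((x 0 * rpd 0 p x + x 1 * rpd 1 p x) ^ 2 - angularDeriv p x ^ 2) := by
  have hp0 := contDiff_rpd hp 0
  have hp1 := contDiff_rpd hp 1
  rw [rpd_hessFlux hp hx, rpd_hessFlux hp hx, rpd_rlap hp, rpd_rlap hp,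
    rpd_comm (hp1.of_le (by norm_cast)) 0 1, rpd_comm (hp.of_le (by norm_cast)) 0 1,
    rpd_comm (hp0.of_le (by norm_cast)) 0 1]
  rw [rlap, rlap, rhess2, angularDeriv, rpd_comm (hp.of_le (by norm_cast)) 0 1]
  linear_combination (-2 * (rpd 0 (rpd 0 p) x + rpd 1 (rpd 1 p) x) * p x * invSq x
    + invSq x * (rpd 0 p x ^ 2 + rpd 1 p x ^ 2)) * invSq_mul hx

lemma rpd_angularFlux (hp : ContDiff ℝ ∞ p) (hx : x ≠ 0) (i : Fin 2) :
    rpd i (angularFlux p i) x =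
      quarterTurn i x * (4 * (rpd i p x + x 0 * rpd i (rpd 0 p) x + x 1 * rpd i (rpd 1 p) x)
          * angularDeriv p x
        + 4 * (x 0 * rpd 0 p x + x 1 * rpd 1 p x) * rpd i (angularDeriv p) x
        - 2 * rpd i p x * angularDeriv p x - 2 * p x * rpd i (angularDeriv p) x) * invSq x ^ 2
      - quarterTurn i x * (4 * (x 0 * rpd 0 p x + x 1 * rpd 1 p x) * angularDeriv p x
        - 2 * p x * angularDeriv p x) * (4 * x i * invSq x ^ 3)
      + (p x ^ 2 - 2 * angularDeriv p x ^ 2) * (invSq x ^ 2 - 4 * x i ^ 2 * invSq x ^ 3)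
      + x i * (2 * p x * rpd i p x - 4 * angularDeriv p x * rpd i (angularDeriv p) x)
        * invSq x ^ 2 := by
  have hσ : DifferentiableAt ℝ invSq x :=
    (contDiffAt_invSq hx (n := 1)).differentiableAt (by norm_num)
  have hdp : Differentiable ℝ p := hp.differentiable (by norm_num)
  have h0 := differentiable_rpd hp 0
  have h1 := differentiable_rpd hp 1
  have ha := (contDiff_angularDeriv hp).differentiable (by norm_num)
  have eσ := rpd_invSq hx (i := i)
  have hr : rpd i (quarterTurn i) x = 0 := by
    fin_cases i
    · have : quarterTurn 0 = fun x : E2 => -x 1 := rfl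
      simp [this, rpd_neg, rpd_coord]
    · have : quarterTurn 1 = fun x : E2 => x 0 := rfl
      simp [this, rpd_coord]
  have hrd : Differentiable ℝ (quarterTurn i) := by
    unfold quarterTurn
    split_ifs <;> fun_prop
  unfold angularFlux
  generalize ei : rpd i p = pi at *
  generalize e0 : rpd 0 p = p0 at *
  generalize e1 : rpd 1 p = p1 at *
  generalize ea : angularDeriv p = a at *
  simp (disch := fun_prop) only [rpd_add, rpd_sub, rpd_mul, rpd_const, rpd_pow_two, rpd_coord,
    eσ, ei, hr]
  fin_cases i
  · have hpi : pi = p0 := by rw [← ei, ← e0]; rfl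
    simp [hpi]
    ring
  · have hpi : pi = p1 := by rw [← ei, ← e1]; rfl
    simp [hpi]
    ring

lemma div_angularFlux (hp : ContDiff ℝ ∞ p) (hx : x ≠ 0) :
    rpd 0 (angularFlux p 0) x + rpd 1 (angularFlux p 1) x =
      invSq x ^ 2 * (
        4 * (x 0 * rpd 0 p x + x 1 * rpd 1 p x) * angularDeriv (angularDeriv p) x
        + 2 * angularDeriv p x ^ 2 + 2 * (x 0 * rpd 0 p x + x 1 * rpd 1 p x) * p x
        - 2 * p x ^ 2 - 2 * p x * angularDeriv (angularDeriv p) x) := by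
  rw [rpd_angularFlux hp hx, rpd_angularFlux hp hx, angularDeriv_angularDeriv hp,
    rpd_angularDeriv hp, rpd_angularDeriv hp, rpd_comm (hp.of_le (by norm_cast)) 0 1]
  simp only [quarterTurn, angularDeriv]
  simp only [if_true, one_ne_zero, if_false]
  linear_combination (-4 * invSq x ^ 2 * (p x ^ 2 - 2 * (x 0 * rpd 1 p x - x 1 * rpd 0 p x) ^ 2))
    * invSq_mul hx

end Divergence

section Wirtinger

lemma norm_fourierCoeffOn_le_of_hasDerivAt {h h' : ℝ → ℂ}
    (hd : ∀ t, HasDerivAt h (h' t) t) (hc : Continuous h') (hper : h (2 * π) = h 0)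
    (hmean : ∫ t in (0)..(2 * π), h t = 0) (n : ℤ) :
    ‖fourierCoeffOn Real.two_pi_pos h n‖ ≤ ‖fourierCoeffOn Real.two_pi_pos h' n‖ := by
  by_cases hn : n = 0
  · subst hn
    have : fourierCoeffOn Real.two_pi_pos h 0 = 0 := by
      simp [fourierCoeffOn_eq_integral, hmean]
    simp [this]
  · have hn1 : (1 : ℝ) ≤ ‖(n : ℂ)‖ := by
      rw [Complex.norm_intCast]
      exact_mod_cast Int.one_le_abs hn
    have hpi : (π : ℂ) ≠ 0 := by exact_mod_cast Real.pi_ne_zero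
    have key : fourierCoeffOn Real.two_pi_pos h' n =
        Complex.I * n * fourierCoeffOn Real.two_pi_pos h n := by
      rw [fourierCoeffOn_of_hasDerivAt Real.two_pi_pos hn (fun t _ => hd t)
        (hc.intervalIntegrable _ _), hper]
      have hn' : (n : ℂ) ≠ 0 := by exact_mod_cast hn
      have hI := Complex.I_ne_zero
      push_cast
      field_simp
      ring
    rw [key, norm_mul, norm_mul, Complex.norm_I, one_mul]
    exact le_mul_of_one_le_left (norm_nonneg _) hn1

/-- **Wirtinger's inequality** for `2π`-periodic functions of mean zero. -/
lemma integral_sq_le_integral_sq_of_hasDerivAt {h h' : ℝ → ℝ}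
    (hd : ∀ t, HasDerivAt h (h' t) t) (hc : Continuous h') (hper : h (2 * π) = h 0)
    (hmean : ∫ t in (0)..(2 * π), h t = 0) :
    ∫ t in (0)..(2 * π), h t ^ 2 ≤ ∫ t in (0)..(2 * π), h' t ^ 2 := by
  have hcont : Continuous h := continuous_iff_continuousAt.2 fun t => (hd t).continuousAt
  have parseval (f : ℝ → ℝ) (hf : Continuous f) :
      HasSum (fun n => ‖fourierCoeffOn Real.two_pi_pos (fun t => (f t : ℂ)) n‖ ^ 2)
        ((2 * π)⁻¹ * ∫ t in (0)..(2 * π), f t ^ 2) := by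
    have hf' : Continuous fun t => (f t : ℂ) := by fun_prop
    have hm : MemLp (fun t => (f t : ℂ)) 2 (volume.restrict (Set.Ioc 0 (2 * π))) :=
      ((memLp_two_iff_integrable_sq_norm hf'.aestronglyMeasurable).2
        ((hf'.norm.pow 2).integrableOn_Icc.mono_set Set.Ioc_subset_Icc_self))
    simpa using hasSum_sq_fourierCoeffOn Real.two_pi_pos hm
  have hle := hasSum_le (fun n => ?_) (parseval h hcont) (parseval h' hc)
  · exact le_of_mul_le_mul_left hle (by positivity)
  · refine pow_le_pow_left₀ (norm_nonneg _) ?_ 2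
    refine norm_fourierCoeffOn_le_of_hasDerivAt (fun t => (hd t).ofReal_comp) (by fun_prop)
      (by simp [hper]) ?_ n
    rw [intervalIntegral.integral_ofReal, hmean, Complex.ofReal_zero]

end Wirtinger

section Rotation

/-- Rotation of the plane by the angle `θ`. -/
def planeRotation (θ : ℝ) (x : E2) : E2 :=
  !₂[Real.cos θ * x 0 - Real.sin θ * x 1, Real.sin θ * x 0 + Real.cos θ * x 1]

lemma norm_planeRotation (θ : ℝ) (x : E2) : ‖planeRotation θ x‖ = ‖x‖ := by
  rw [← sq_eq_sq₀ (norm_nonneg _) (norm_nonneg _)]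
  simp only [EuclideanSpace.norm_sq_eq, planeRotation, Fin.sum_univ_two, Real.norm_eq_abs, sq_abs]
  simp
  linear_combination (x 0 ^ 2 + x 1 ^ 2) * Real.sin_sq_add_cos_sq θ

lemma invSq_planeRotation (θ : ℝ) (x : E2) : invSq (planeRotation θ x) = invSq x := by
  have h (y : E2) : invSq y = (‖y‖ ^ 2)⁻¹ := by simp [invSq, EuclideanSpace.norm_sq_eq]
  rw [h, h, norm_planeRotation]

/-- Rotation of the plane as a linear isometry. -/
def rotationIsometry (θ : ℝ) : E2 →ₗᵢ[ℝ] E2 where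
  toFun := planeRotation θ
  map_add' x y := by ext i; fin_cases i <;> simp [planeRotation] <;> ring
  map_smul' c x := by ext i; fin_cases i <;> simp [planeRotation] <;> ring
  norm_map' := norm_planeRotation θ

lemma integral_comp_planeRotation (f : E2 → ℝ) (θ : ℝ) :
    ∫ x, f (planeRotation θ x) = ∫ x, f x :=
  let e := (rotationIsometry θ).toLinearIsometryEquiv rfl
  e.measurePreserving.integral_comp e.toHomeomorph.measurableEmbedding f

lemma continuous_planeRotation : Continuous fun z : ℝ × E2 => planeRotation z.1 z.2 := by
  unfold planeRotation
  refine (PiLp.continuous_toLp 2 _).comp (continuous_pi fun i => ?_)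
  fin_cases i <;> simp <;> fun_prop

lemma continuous_planeRotation_left (x : E2) : Continuous fun t => planeRotation t x := by
  unfold planeRotation
  refine (PiLp.continuous_toLp 2 _).comp (continuous_pi fun i => ?_)
  fin_cases i <;> simp <;> fun_prop

lemma planeRotation_two_pi (x : E2) : planeRotation (2 * π) x = planeRotation 0 x := by
  simp [planeRotation]

lemma hasDerivAt_comp_planeRotation {f : E2 → ℝ} (hf : Differentiable ℝ f) (x : E2) (θ : ℝ) :
    HasDerivAt (fun t => f (planeRotation t x)) (angularDeriv f (planeRotation θ x)) θ := by
  have hr : HasDerivAt (fun t => planeRotation t x)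
      (planeRotation θ x 0 • EuclideanSpace.single 1 1 -
        planeRotation θ x 1 • EuclideanSpace.single 0 1) θ := by
    have : HasDerivAt (fun t => ![Real.cos t * x 0 - Real.sin t * x 1,
        Real.sin t * x 0 + Real.cos t * x 1])
        ![-Real.sin θ * x 0 - Real.cos θ * x 1, Real.cos θ * x 0 + -Real.sin θ * x 1] θ := by
      rw [hasDerivAt_pi]
      intro i
      fin_cases i
      · exact ((Real.hasDerivAt_cos θ).mul_const _).sub ((Real.hasDerivAt_sin θ).mul_const _)
      · exact ((Real.hasDerivAt_sin θ).mul_const _).add ((Real.hasDerivAt_cos θ).mul_const _)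
    have h2 := (PiLp.continuousLinearEquiv 2 ℝ
      (fun _ : Fin 2 => ℝ)).symm.toContinuousLinearMap.hasFDerivAt.comp_hasDerivAt θ this
    convert! h2 using 1
    ext i
    fin_cases i <;> simp [planeRotation] <;> ring
  convert! (hf (planeRotation θ x)).hasFDerivAt.comp_hasDerivAt θ hr using 1
  simp [angularDeriv, rpd]

lemma integral_nonneg_of_planeRotation {f : E2 → ℝ} (hf : Continuous f) (hs : HasCompactSupport f)
    (h : ∀ x, 0 ≤ ∫ t in (0)..(2 * π), f (planeRotation t x)) : 0 ≤ ∫ x, f x := by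
  obtain ⟨R, hR⟩ := hs.isCompact.isBounded.subset_closedBall (0 : E2)
  have hout (t : ℝ) : ∫ x in Metric.closedBall 0 R, f (planeRotation t x) = ∫ x, f x := by
    rw [← integral_comp_planeRotation f t]
    refine setIntegral_eq_integral_of_forall_compl_eq_zero fun x hx => ?_
    refine image_eq_zero_of_notMem_tsupport fun hx' => hx ?_
    simpa [norm_planeRotation] using hR hx'
  have hint : Integrable (fun z : ℝ × E2 => f (planeRotation z.1 z.2))
      ((volume.restrict (Set.Ioc 0 (2 * π))).prod
        (volume.restrict (Metric.closedBall (0 : E2) R))) := by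
    rw [Measure.prod_restrict]
    have hK : IsCompact (Set.Icc 0 (2 * π) ×ˢ Metric.closedBall (0 : E2) R) :=
      isCompact_Icc.prod (isCompact_closedBall 0 R)
    exact ((hf.comp continuous_planeRotation).continuousOn.integrableOn_compact hK).mono_set
      (Set.prod_mono Set.Ioc_subset_Icc_self subset_rfl)
  have hswap := integral_integral_swap (f := fun t x => f (planeRotation t x)) hint
  simp only [hout] at hswap
  have hnonneg : 0 ≤ ∫ x in Metric.closedBall (0 : E2) R,
      ∫ t in Set.Ioc 0 (2 * π), f (planeRotation t x) :=
    integral_nonneg fun x => by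
      simpa [intervalIntegral.integral_of_le Real.two_pi_pos.le] using h x
  rw [← hswap] at hnonneg
  simp only [integral_const, measureReal_restrict_apply_univ, Real.volume_real_Ioc, smul_eq_mul,
    sub_zero, max_eq_left Real.two_pi_pos.le] at hnonneg
  exact nonneg_of_mul_nonneg_right hnonneg Real.two_pi_pos

end Rotation

/-- The pointwise difference of the two sides of Wirtinger's inequality for the angular derivative,
weighted by `|x|⁻⁴`. -/
def angularDefect (p : E2 → ℝ) (x : E2) : ℝ :=
  invSq x ^ 2 * (angularDeriv (angularDeriv p) x ^ 2 - angularDeriv p x ^ 2)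

section RealInequality

variable {p : E2 → ℝ} {x : E2}

lemma rpd_eq_zero_of_forall_notMem {f : E2 → ℝ} (h : ∀ x ∉ tsupport p, f x = 0)
    (hx : x ∉ tsupport p) (i : Fin 2) : rpd i f x = 0 :=
  rpd_eq_zero_of_notMem fun hx' => hx <|
    closure_minimal (Function.support_subset_iff'.2 h) (isClosed_tsupport p) hx'

lemma rpd_rpd_eq_zero_of_notMem (hx : x ∉ tsupport p) (i j : Fin 2) :
    rpd i (rpd j p) x = 0 :=
  rpd_eq_zero_of_forall_notMem (fun _ h => rpd_eq_zero_of_notMem h) hx i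

lemma rlap_eq_zero_of_notMem (hx : x ∉ tsupport p) : rlap p x = 0 := by
  simp [rlap, rpd_rpd_eq_zero_of_notMem hx]

lemma angularDeriv_eq_zero_of_notMem (hx : x ∉ tsupport p) : angularDeriv p x = 0 := by
  simp [angularDeriv, rpd_eq_zero_of_notMem hx]

lemma angularDeriv_angularDeriv_eq_zero_of_notMem (hx : x ∉ tsupport p) :
    angularDeriv (angularDeriv p) x = 0 := by
  rw [angularDeriv]
  simp [rpd_eq_zero_of_forall_notMem (fun _ => angularDeriv_eq_zero_of_notMem) hx]

lemma rhess2_eq_zero_of_notMem (hx : x ∉ tsupport p) : rhess2 p x = 0 := by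
  simp [rhess2, rpd_rpd_eq_zero_of_notMem hx]

lemma hessFlux_eq_zero_of_notMem (hx : x ∉ tsupport p) (i : Fin 2) : hessFlux p i x = 0 := by
  simp [hessFlux, rlap_eq_zero_of_notMem hx, image_eq_zero_of_notMem_tsupport hx,
    rpd_eq_zero_of_notMem hx]

lemma angularFlux_eq_zero_of_notMem (hx : x ∉ tsupport p) (i : Fin 2) :
    angularFlux p i x = 0 := by
  simp [angularFlux, angularDeriv_eq_zero_of_notMem hx, image_eq_zero_of_notMem_tsupport hx]

lemma contDiff_hessFlux (hp : ContDiff ℝ ∞ p) (h0 : (0 : E2) ∉ tsupport p) (i : Fin 2) :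
    ContDiff ℝ ∞ (hessFlux p i) := by
  refine contDiff_of_forall_mem_tsupport (p := p) (fun x hx => ?_)
    fun x hx => hessFlux_eq_zero_of_notMem hx i
  have hx0 : x ≠ 0 := by rintro rfl; exact h0 hx
  have hw := contDiffAt_logWeight hx0 (n := ∞)
  have hσ := contDiffAt_invSq hx0 (n := ∞)
  have hr0 := contDiff_rpd hp 0
  have hr1 := contDiff_rpd hp 1
  have hri := contDiff_rpd hp i
  have hr0i := contDiff_rpd hr0 i
  have hr1i := contDiff_rpd hr1 i
  have hl := contDiff_rlap hp
  have hli := contDiff_rpd hl i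
  unfold hessFlux
  fun_prop

lemma contDiff_angularFlux (hp : ContDiff ℝ ∞ p) (h0 : (0 : E2) ∉ tsupport p) (i : Fin 2) :
    ContDiff ℝ ∞ (angularFlux p i) := by
  refine contDiff_of_forall_mem_tsupport (p := p) (fun x hx => ?_)
    fun x hx => angularFlux_eq_zero_of_notMem hx i
  have hx0 : x ≠ 0 := by rintro rfl; exact h0 hx
  have hσ := contDiffAt_invSq hx0 (n := ∞)
  have hr0 := contDiff_rpd hp 0
  have hr1 := contDiff_rpd hp 1
  have ha := contDiff_angularDeriv hp
  have hq : ContDiff ℝ ∞ (quarterTurn i) := by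
    unfold quarterTurn
    split_ifs <;> fun_prop
  unfold angularFlux
  fun_prop

lemma contDiff_rhess2 (hp : ContDiff ℝ ∞ p) : ContDiff ℝ ∞ (rhess2 p) := by
  have h00 := contDiff_rpd (contDiff_rpd hp 0) 0
  have h01 := contDiff_rpd (contDiff_rpd hp 1) 0
  have h11 := contDiff_rpd (contDiff_rpd hp 1) 1
  unfold rhess2
  fun_prop

lemma integrable_of_contDiffAt_of_tsupport (hs : HasCompactSupport p) {f : E2 → ℝ}
    (hf : ∀ x ∈ tsupport p, ContDiffAt ℝ 0 f x) (h : ∀ x ∉ tsupport p, f x = 0) :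
    Integrable f :=
  (contDiff_of_forall_mem_tsupport hf h).continuous.integrable_of_hasCompactSupport
    (HasCompactSupport.intro hs h)

lemma integrable_rhess2_mul (hp : ContDiff ℝ ∞ p) (hs : HasCompactSupport p)
    (h0 : (0 : E2) ∉ tsupport p) :
    Integrable fun x => rhess2 p x * (logWeight x - 2) := by
  refine integrable_of_contDiffAt_of_tsupport hs (fun x hx => ?_)
    fun x hx => by simp [rhess2_eq_zero_of_notMem hx]
  have hw := contDiffAt_logWeight (x := x) (n := 0) (by rintro rfl; exact h0 hx)
  have hr := (contDiff_rhess2 hp).of_le (m := 0) (by simp)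
  fun_prop

lemma integrable_rlap_rlap_mul (hp : ContDiff ℝ ∞ p) (hs : HasCompactSupport p)
    (h0 : (0 : E2) ∉ tsupport p) {f : E2 → ℝ} (hf : ContDiff ℝ ∞ f) :
    Integrable fun x => rlap (rlap f) x * p x * logWeight x := by
  refine integrable_of_contDiffAt_of_tsupport hs (fun x hx => ?_)
    fun x hx => by simp [image_eq_zero_of_notMem_tsupport hx]
  have hw := contDiffAt_logWeight (x := x) (n := 0) (by rintro rfl; exact h0 hx)
  have hr := (contDiff_rlap (contDiff_rlap hf)).of_le (m := 0) (by simp)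
  have hp := hp.of_le (m := 0) (by simp)
  fun_prop

/-- The tangential second derivative is controlled by the Hessian. -/
lemma sq_add_angularDeriv_le (hp : ContDiff ℝ ∞ p) (hx : x ≠ 0) :
    invSq x ^ 2 * (x 0 * rpd 0 p x + x 1 * rpd 1 p x + angularDeriv (angularDeriv p) x) ^ 2
      ≤ rhess2 p x := by
  have hs : invSq x ^ 2 * (x 0 ^ 2 + x 1 ^ 2) ^ 2 = 1 := by
    rw [← mul_pow, invSq_mul hx, one_pow]
  have key : (x 0 * rpd 0 p x + x 1 * rpd 1 p x + angularDeriv (angularDeriv p) x) ^ 2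
      ≤ (x 0 ^ 2 + x 1 ^ 2) ^ 2 * rhess2 p x := by
    rw [angularDeriv_angularDeriv hp, rhess2]
    generalize rpd 0 (rpd 0 p) x = a
    generalize rpd 0 (rpd 1 p) x = b
    generalize rpd 1 (rpd 1 p) x = c
    nlinarith [sq_nonneg (x 1 ^ 2 * b + x 0 * x 1 * a), sq_nonneg (x 0 ^ 2 * b + x 0 * x 1 * c),
      sq_nonneg (x 1 ^ 2 * c - x 0 ^ 2 * a)]
  calc _ ≤ invSq x ^ 2 * ((x 0 ^ 2 + x 1 ^ 2) ^ 2 * rhess2 p x) :=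
        mul_le_mul_of_nonneg_left key (by positivity)
    _ = rhess2 p x := by rw [← mul_assoc, hs, one_mul]

lemma div_flux_add_le (hp : ContDiff ℝ ∞ p) (hx : x ≠ 0) :
    rpd 0 (hessFlux p 0) x + rpd 1 (hessFlux p 1) x
      + (rpd 0 (angularFlux p 0) x + rpd 1 (angularFlux p 1) x)
      + angularDefect p x
    ≤ rlap (rlap p) x * p x * logWeight x - rhess2 p x * (logWeight x - 2) := by
  rw [div_hessFlux hp hx, div_angularFlux hp hx, angularDefect]
  have h := sq_add_angularDeriv_le hp hx
  have h1 := mul_nonneg (sq_nonneg (invSq x))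
    (sq_nonneg (x 0 * rpd 0 p x + x 1 * rpd 1 p x - p x))
  have h2 := mul_nonneg (sq_nonneg (invSq x))
    (sq_nonneg (angularDeriv (angularDeriv p) x + p x))
  linarith

lemma angularDefect_eq_zero_of_notMem (hx : x ∉ tsupport p) : angularDefect p x = 0 := by
  simp [angularDefect, angularDeriv_eq_zero_of_notMem hx,
    angularDeriv_angularDeriv_eq_zero_of_notMem hx]

lemma continuous_angularDefect (hp : ContDiff ℝ ∞ p) (h0 : (0 : E2) ∉ tsupport p) :
    Continuous (angularDefect p) := by
  have ha := (contDiff_angularDeriv hp).of_le (m := 0) (by simp)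
  have haa := (contDiff_angularDeriv (contDiff_angularDeriv hp)).of_le (m := 0) (by simp)
  refine ContDiff.continuous (𝕜 := ℝ) (n := 0) ?_
  refine contDiff_of_forall_mem_tsupport (p := p) (fun x hx => ?_)
    fun x hx => angularDefect_eq_zero_of_notMem hx
  have hσ := contDiffAt_invSq (x := x) (n := 0) (by rintro rfl; exact h0 hx)
  unfold angularDefect
  generalize angularDeriv (angularDeriv p) = b at *
  generalize angularDeriv p = a at *
  fun_prop

lemma integral_angularDefect_nonneg (hp : ContDiff ℝ ∞ p) (hs : HasCompactSupport p)
    (h0 : (0 : E2) ∉ tsupport p) : 0 ≤ ∫ x, angularDefect p x := by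
  have ha := contDiff_angularDeriv hp
  have haa := contDiff_angularDeriv ha
  have hcs : HasCompactSupport (angularDefect p) :=
    HasCompactSupport.intro hs fun _ => angularDefect_eq_zero_of_notMem
  refine integral_nonneg_of_planeRotation (continuous_angularDefect hp h0) hcs fun x => ?_
  have hrot := continuous_planeRotation_left x
  have hper := planeRotation_two_pi x
  have hd (t : ℝ) := hasDerivAt_comp_planeRotation (hp.differentiable (by simp)) x t
  have hd' (t : ℝ) := hasDerivAt_comp_planeRotation (ha.differentiable (by simp)) x t
  have hca : Continuous fun t => angularDeriv p (planeRotation t x) := ha.continuous.comp hrot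
  have hcaa : Continuous fun t => angularDeriv (angularDeriv p) (planeRotation t x) :=
    haa.continuous.comp hrot
  have hmean : ∫ t in (0)..(2 * π), angularDeriv p (planeRotation t x) = 0 := by
    rw [intervalIntegral.integral_eq_sub_of_hasDerivAt (fun t _ => hd t)
      (hca.intervalIntegrable _ _), hper, sub_self]
  have hw := integral_sq_le_integral_sq_of_hasDerivAt hd' hcaa (by simp only [hper]) hmean
  simp only [angularDefect, invSq_planeRotation]
  have hi := (hca.pow 2).intervalIntegrable (μ := volume) 0 (2 * π)
  have hi' := (hcaa.pow 2).intervalIntegrable (μ := volume) 0 (2 * π)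
  simp only [Pi.pow_def] at hi hi'
  rw [intervalIntegral.integral_const_mul, intervalIntegral.integral_sub hi' hi]
  exact mul_nonneg (sq_nonneg _) (sub_nonneg.2 hw)

/-- The weighted Gårding type inequality for real-valued functions. -/
lemma integral_rhess2_mul_le (hp : ContDiff ℝ ∞ p) (hs : HasCompactSupport p)
    (h0 : (0 : E2) ∉ tsupport p) :
    ∫ x, rhess2 p x * (logWeight x - 2) ≤ ∫ x, rlap (rlap p) x * p x * logWeight x := by
  have hnonneg := integral_angularDefect_nonneg hp hs h0
  have hi : Integrable (angularDefect p) :=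
    (continuous_angularDefect hp h0).integrable_of_hasCompactSupport
      (HasCompactSupport.intro hs fun x hx => angularDefect_eq_zero_of_notMem hx)
  have hflux {f : E2 → ℝ} (hf : ContDiff ℝ ∞ f) (hz : ∀ x ∉ tsupport p, f x = 0) (i : Fin 2) :
      Integrable (rpd i f) ∧ ∫ x, rpd i f x = 0 :=
    ⟨(contDiff_rpd hf i).continuous.integrable_of_hasCompactSupport
      (HasCompactSupport.intro hs fun x hx => rpd_eq_zero_of_forall_notMem hz hx i),
      integral_rpd_eq_zero (hf.of_le (by norm_cast)) (HasCompactSupport.intro hs hz) i⟩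
  have hH (i : Fin 2) := hflux (contDiff_hessFlux hp h0 i)
    (fun x hx => hessFlux_eq_zero_of_notMem hx i) i
  have hA (i : Fin 2) := hflux (contDiff_angularFlux hp h0 i)
    (fun x hx => angularFlux_eq_zero_of_notMem hx i) i
  have hL := integrable_rlap_rlap_mul hp hs h0 hp
  have hR := integrable_rhess2_mul hp hs h0
  have hHI := (hH 0).1.add (hH 1).1
  have hAI := (hA 0).1.add (hA 1).1
  have hmono := integral_mono ((hHI.add hAI).add hi) (hL.sub hR) fun x => by
    by_cases hx : x ∈ tsupport p
    · exact div_flux_add_le hp (by rintro rfl; exact h0 hx)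
    · simp [rpd_eq_zero_of_forall_notMem (fun _ h => hessFlux_eq_zero_of_notMem h _) hx,
        rpd_eq_zero_of_forall_notMem (fun _ h => angularFlux_eq_zero_of_notMem h _) hx,
        angularDefect_eq_zero_of_notMem hx,
        rhess2_eq_zero_of_notMem hx, image_eq_zero_of_notMem_tsupport hx]
  rw [integral_add' (hHI.add hAI) hi, integral_add' hHI hAI, integral_add' (hH 0).1 (hH 1).1,
    integral_add' (hA 0).1 (hA 1).1, integral_sub' hL hR, (hH 0).2, (hH 1).2, (hA 0).2,
    (hA 1).2] at hmono
  linarith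

end RealInequality

section Complex

variable {u : E2 → ℂ} {x : E2}

lemma pd_re (hu : Differentiable ℝ u) (i : Fin 2) :
    (fun x => (pd i u x).re) = rpd i fun x => (u x).re := by
  ext x
  have h := (Complex.reCLM.hasFDerivAt.comp x (hu x).hasFDerivAt).fderiv
  rw [rpd, show (fun x => (u x).re) = Complex.reCLM ∘ u from rfl, h]
  rfl

lemma pd_im (hu : Differentiable ℝ u) (i : Fin 2) :
    (fun x => (pd i u x).im) = rpd i fun x => (u x).im := by
  ext x
  have h := (Complex.imCLM.hasFDerivAt.comp x (hu x).hasFDerivAt).fderiv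
  rw [rpd, show (fun x => (u x).im) = Complex.imCLM ∘ u from rfl, h]
  rfl

lemma contDiff_pd (hu : ContDiff ℝ ∞ u) (i : Fin 2) : ContDiff ℝ ∞ (pd i u) :=
  (hu.fderiv_right (by norm_cast)).clm_apply contDiff_const

lemma pd_pd_re (hu : ContDiff ℝ ∞ u) (i j : Fin 2) (x : E2) :
    (pd i (pd j u) x).re = rpd i (rpd j fun x => (u x).re) x := by
  rw [← pd_re (hu.differentiable (by simp)),
    ← pd_re ((contDiff_pd hu j).differentiable (by simp))]

lemma pd_pd_im (hu : ContDiff ℝ ∞ u) (i j : Fin 2) (x : E2) :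
    (pd i (pd j u) x).im = rpd i (rpd j fun x => (u x).im) x := by
  rw [← pd_im (hu.differentiable (by simp)),
    ← pd_im ((contDiff_pd hu j).differentiable (by simp))]

lemma contDiff_lap (hu : ContDiff ℝ ∞ u) : ContDiff ℝ ∞ (lap u) :=
  (contDiff_pd (contDiff_pd hu 0) 0).add (contDiff_pd (contDiff_pd hu 1) 1)

lemma lap_re (hu : ContDiff ℝ ∞ u) : (fun x => (lap u x).re) = rlap fun x => (u x).re := by
  ext x
  simp [lap, rlap, pd_pd_re hu]

lemma lap_im (hu : ContDiff ℝ ∞ u) : (fun x => (lap u x).im) = rlap fun x => (u x).im := by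
  ext x
  simp [lap, rlap, pd_pd_im hu]

lemma lap_lap_eq (hu : ContDiff ℝ ∞ u) (x : E2) :
    lap (lap u) x = ⟨rlap (rlap fun x => (u x).re) x, rlap (rlap fun x => (u x).im) x⟩ := by
  rw [← lap_re hu, ← lap_im hu, ← lap_re (contDiff_lap hu), ← lap_im (contDiff_lap hu)]

lemma hess2_eq (hu : ContDiff ℝ ∞ u) (x : E2) :
    hess2 u x = rhess2 (fun x => (u x).re) x + rhess2 (fun x => (u x).im) x := by
  simp only [hess2, rhess2, Complex.sq_norm, Complex.normSq_apply, pd_pd_re hu, pd_pd_im hu]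
  ring

end Complex

/-- Weighted Gårding type inequality for the biharmonic operator, for test functions
supported away from the origin. -/
theorem weighted_garding_inequality
    (u : E2 → ℂ) (hu : ContDiff ℝ (⊤ : ℕ∞) u) (hsupp : HasCompactSupport u)
    (h0 : (0 : E2) ∉ tsupport u) :
    (∫ x : E2, hess2 u x * Real.log (1 / (Real.exp 2 * ‖x‖))) ≤
      (∫ x : E2, lap (lap u) x * (starRingEnd ℂ) (u x) *
        (Real.log (1 / ‖x‖) : ℂ)).re := by
  have hre : ContDiff ℝ ∞ fun x => (u x).re := Complex.reCLM.contDiff.comp hu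
  have him : ContDiff ℝ ∞ fun x => (u x).im := Complex.imCLM.contDiff.comp hu
  have tre : tsupport (fun x => (u x).re) ⊆ tsupport u :=
    tsupport_comp_subset (g := Complex.re) rfl u
  have tim : tsupport (fun x => (u x).im) ⊆ tsupport u :=
    tsupport_comp_subset (g := Complex.im) rfl u
  have sre : HasCompactSupport fun x => (u x).re := hsupp.comp_left (g := Complex.re) rfl
  have sim : HasCompactSupport fun x => (u x).im := hsupp.comp_left (g := Complex.im) rfl
  have zre := fun h => h0 (tre h)
  have zim := fun h => h0 (tim h)
  have hleft (x : E2) : hess2 u x * Real.log (1 / (Real.exp 2 * ‖x‖)) =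
      rhess2 (fun x => (u x).re) x * (logWeight x - 2)
        + rhess2 (fun x => (u x).im) x * (logWeight x - 2) := by
    rw [hess2_eq hu]
    by_cases hx : x = 0
    · subst hx
      simp [rhess2_eq_zero_of_notMem zre, rhess2_eq_zero_of_notMem zim]
    · have hx' : ‖x‖ ≠ 0 := norm_ne_zero_iff.2 hx
      rw [logWeight_eq, one_div, one_div, Real.log_inv, Real.log_inv,
        Real.log_mul (Real.exp_ne_zero 2) hx', Real.log_exp]
      ring
  have hright (x : E2) :
      lap (lap u) x * (starRingEnd ℂ) (u x) * (Real.log (1 / ‖x‖) : ℂ) =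
        ((rlap (rlap fun x => (u x).re) x * (u x).re * logWeight x
          + rlap (rlap fun x => (u x).im) x * (u x).im * logWeight x : ℝ) : ℂ)
        + ((rlap (rlap fun x => (u x).im) x * (u x).re * logWeight x
          - rlap (rlap fun x => (u x).re) x * (u x).im * logWeight x : ℝ) : ℂ) * Complex.I := by
    rw [lap_lap_eq hu, ← logWeight_eq]
    apply Complex.ext
    · simp
      ring
    · simp
      ring
  have Irr := integrable_rlap_rlap_mul hre sre zre hre
  have Iii := integrable_rlap_rlap_mul him sim zim him
  have Iri := integrable_rlap_rlap_mul hre sre zre him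
  have Iir := integrable_rlap_rlap_mul him sim zim hre
  simp only [hleft, hright]
  rw [integral_add (integrable_rhess2_mul hre sre zre) (integrable_rhess2_mul him sim zim),
    integral_add (Irr.add Iii).ofReal ((Iri.sub Iir).ofReal.mul_const _),
    integral_mul_const, integral_complex_ofReal, integral_complex_ofReal,
    integral_add Irr Iii]
  simp only [Complex.add_re, Complex.ofReal_re, Complex.re_ofReal_mul, Complex.I_re, mul_zero,
    add_zero]
  exact add_le_add (integral_rhess2_mul_le hre sre zre) (integral_rhess2_mul_le him sim zim)
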